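/- arXiv:2006.13722 — 4 statements merged into one kernel-verified Lean document; each statement's English description precedes it below -/
import Mathlib

section
/- Let G be a stacked triangulation with at least 7 vertices, and consider all 3-element vertex sets that occur as a face at some stage of the inductive construction of G and have at least 4 interior vertices (this collection is nonempty, since the outer face of G qualifies). If t is such a set whose number of interior vertices is minimal among the collection, then t has at most 10 interior vertices. -/
namespace Guarding

/-- `IsStacked V E out F` means: the finite simple graph with vertex set `V`, edge set `E`
(edges as unordered pairs), outer face `out` and set of inner faces `F`
(each face identified with its 3-element set of boundary vertices)
is a stacked triangulation, built by the inductive construction: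
the triangle on three vertices is a stacked triangulation whose outer face is `{x,y,z}` and
whose set of inner faces is `{{x,y,z}}`; stacking a new vertex `v` into an inner face
`{x,y,z}` adds the edges `vx, vy, vz` and replaces the face `{x,y,z}` by the three faces
`{v,x,y}, {v,y,z}, {v,z,x}`. -/
inductive IsStacked : Finset ℕ → Finset (Sym2 ℕ) → Finset ℕ → Finset (Finset ℕ) → Prop
  | base (x y z : ℕ) (hxy : x ≠ y) (hyz : y ≠ z) (hxz : x ≠ z) :
      IsStacked {x, y, z} {s(x, y), s(y, z), s(x, z)} {x, y, z} {{x, y, z}}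
  | stack {V : Finset ℕ} {E : Finset (Sym2 ℕ)} {out : Finset ℕ} {F : Finset (Finset ℕ)}
      (x y z v : ℕ) (hG : IsStacked V E out F) (hf : ({x, y, z} : Finset ℕ) ∈ F)
      (hv : v ∉ V) :
      IsStacked (insert v V) (E ∪ {s(v, x), s(v, y), s(v, z)}) out
        ((F.erase {x, y, z}) ∪ {{v, x, y}, {v, y, z}, {v, z, x}})

/-- The faces of the stacked triangulation: its inner faces together with the outer face. -/
def faces (out : Finset ℕ) (F : Finset (Finset ℕ)) : Finset (Finset ℕ) := insert out F

/-- `V(Γ)`: the set of all endpoints of edges of `Γ`. -/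
def gv (Γ : Finset (Sym2 ℕ)) : Set ℕ := {u | ∃ e ∈ Γ, u ∈ e}

/-- `Γ` is an edge guard set: it consists of edges of the graph and every face
contains at least one endpoint of an edge of `Γ`. -/
def IsGuardSet (E : Finset (Sym2 ℕ)) (out : Finset ℕ) (F : Finset (Finset ℕ))
    (Γ : Finset (Sym2 ℕ)) : Prop :=
  Γ ⊆ E ∧ ∀ f ∈ faces out F, ∃ u ∈ gv Γ, u ∈ f

/-- `t` occurs as a face at some stage of the construction of the stacked triangulation
with edge set `E` and inner face set `F`, and `W` is the vertex set of the
sub-triangulation inside `t` (so `t` has `W.card - 3` interior vertices). -/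
def HasSubTri (E : Finset (Sym2 ℕ)) (F : Finset (Finset ℕ)) (t W : Finset ℕ) : Prop :=
  ∃ (Et : Finset (Sym2 ℕ)) (Ft : Finset (Finset ℕ)),
    IsStacked W Et t Ft ∧ Et ⊆ E ∧ Ft ⊆ F

namespace IsStacked

variable {V : Finset ℕ} {E : Finset (Sym2 ℕ)} {out : Finset ℕ} {F : Finset (Finset ℕ)}

theorem three_le_card (h : IsStacked V E out F) : 3 ≤ V.card := by
  induction h with
  | base x y z hxy hyz hxz =>
    exact (Finset.card_eq_three.2 ⟨x, y, z, hxy, hxz, hyz, rfl⟩).ge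
  | stack x y z v hG hf hv ih =>
    rw [Finset.card_insert_of_notMem hv]
    omega

theorem subset_of_mem_face (h : IsStacked V E out F) : ∀ f ∈ F, f ⊆ V := by
  induction h with
  | base x y z hxy hyz hxz => simp
  | stack x y z v hG hf hv ih =>
    have hxyz := ih _ hf
    intro f hf'
    simp only [Finset.mem_union, Finset.mem_erase, Finset.mem_insert,
      Finset.mem_singleton] at hf'
    rcases hf' with ⟨-, h⟩ | rfl | rfl | rfl
    · exact (ih f h).trans (Finset.subset_insert _ _)
    all_goals
      simp only [Finset.insert_subset_iff, Finset.singleton_subset_iff, Finset.mem_insert] at hxyz ⊢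
      tauto

/-- The graph is split into three sub-triangulations around the first stacked vertex. -/
def Splits (V : Finset ℕ) (E : Finset (Sym2 ℕ)) (F : Finset (Finset ℕ)) : Prop :=
  ∃ (W : Fin 3 → Finset ℕ) (D : Fin 3 → Finset (Sym2 ℕ)) (t : Fin 3 → Finset ℕ)
    (H : Fin 3 → Finset (Finset ℕ)),
    (∀ i, IsStacked (W i) (D i) (t i) (H i)) ∧ (∀ i, W i ⊆ V) ∧ (∀ i, D i ⊆ E) ∧
    (∀ f, f ∈ F ↔ ∃ i, f ∈ H i) ∧ (∀ i j f, f ∈ H i → f ∈ H j → i = j) ∧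
    V.card + 5 = ∑ i, (W i).card

theorem splits_of_stack_triangle {x y z v : ℕ} (hxy : x ≠ y) (hyz : y ≠ z) (hxz : x ≠ z)
    (hv : v ∉ ({x, y, z} : Finset ℕ))
    (hE : ∀ u ∈ ({x, y, z} : Finset ℕ), ∀ w ∈ ({x, y, z} : Finset ℕ), u ≠ w → s(u, w) ∈ E) :
    Splits (insert v {x, y, z}) (E ∪ {s(v, x), s(v, y), s(v, z)})
      ((({{x, y, z}} : Finset (Finset ℕ)).erase {x, y, z}) ∪
        {{v, x, y}, {v, y, z}, {v, z, x}}) := by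
  have hcard : ({x, y, z} : Finset ℕ).card = 3 :=
    Finset.card_eq_three.2 ⟨x, y, z, hxy, hxz, hyz, rfl⟩
  have hxyE : s(x, y) ∈ E := hE x (by simp) y (by simp) hxy
  have hyzE : s(y, z) ∈ E := hE y (by simp) z (by simp) hyz
  have hzxE : s(z, x) ∈ E := hE z (by simp) x (by simp) hxz.symm
  have hcardv := Finset.card_insert_of_notMem hv
  simp only [Finset.mem_insert, Finset.mem_singleton, not_or] at hv
  obtain ⟨hvx, hvy, hvz⟩ := hv
  let a : Fin 3 → ℕ := ![x, y, z]
  let b : Fin 3 → ℕ := ![y, z, x]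
  have hva : ∀ i, v ≠ a i := by intro i; fin_cases i <;> assumption
  have hvb : ∀ i, v ≠ b i := by intro i; fin_cases i <;> assumption
  have hab : ∀ i, a i ≠ b i := by
    intro i; fin_cases i
    exacts [hxy, hyz, hxz.symm]
  have hsep : ∀ i j, ({v, a i, b i} : Finset ℕ) = {v, a j, b j} → i = j := by
    intro i j hij
    have hx := Finset.ext_iff.1 hij x
    have hy := Finset.ext_iff.1 hij y
    have hz := Finset.ext_iff.1 hij z
    fin_cases i <;> fin_cases j <;> simp [a, b] at hx hy hz ⊢ <;> grind
  refine ⟨fun i => {v, a i, b i}, fun i => {s(v, a i), s(a i, b i), s(v, b i)},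
    fun i => {v, a i, b i}, fun i => {{v, a i, b i}},
    fun i => IsStacked.base _ _ _ (hva i) (hab i) (hvb i), ?_, ?_, ?_, ?_, ?_⟩
  · intro i
    fin_cases i <;> simp [a, b, Finset.insert_subset_iff]
  · intro i
    fin_cases i <;> simp [a, b, Finset.insert_subset_iff, hxyE, hyzE, hzxE]
  · intro f
    simp [Fin.exists_fin_succ, a, b]
  · intro i j f hi hj
    rw [Finset.mem_singleton] at hi hj
    exact hsep i j (hi.symm.trans hj)
  · have h3 : ∀ i, ({v, a i, b i} : Finset ℕ).card = 3 := fun i =>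
      Finset.card_eq_three.2 ⟨_, _, _, hva i, hvb i, hab i, rfl⟩
    simp [h3, hcardv, hcard]

theorem Splits.stack (hG : IsStacked V E out F) (h : Splits V E F) {x y z v : ℕ}
    (hf : ({x, y, z} : Finset ℕ) ∈ F) (hv : v ∉ V) :
    Splits (insert v V) (E ∪ {s(v, x), s(v, y), s(v, z)})
      ((F.erase {x, y, z}) ∪ {{v, x, y}, {v, y, z}, {v, z, x}}) := by
  obtain ⟨W, D, t, H, hS, hW, hD, hF, hdisj, hsum⟩ := h
  obtain ⟨j, hj⟩ := (hF _).1 hf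
  set N : Finset (Finset ℕ) := {{v, x, y}, {v, y, z}, {v, z, x}} with hN
  have hnew : ∀ f ∈ N, f ∉ F := by
    intro f hfN hfF
    refine hv (hG.subset_of_mem_face f hfF ?_)
    simp only [hN, Finset.mem_insert, Finset.mem_singleton] at hfN
    rcases hfN with rfl | rfl | rfl <;> simp
  have hvW : ∀ i, v ∉ W i := fun i h => hv (hW i h)
  refine ⟨fun i => if i = j then insert v (W i) else W i,
    fun i => if i = j then D i ∪ {s(v, x), s(v, y), s(v, z)} else D i, t,
    fun i => if i = j then (H i).erase {x, y, z} ∪ N else H i, ?_, ?_, ?_, ?_, ?_, ?_⟩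
  · intro i
    by_cases hij : i = j
    · subst hij
      simpa only [if_true] using IsStacked.stack x y z v (hS i) hj (hvW i)
    · simpa [hij] using hS i
  · intro i
    dsimp only
    split_ifs
    · exact Finset.insert_subset_insert _ (hW i)
    · exact (hW i).trans (Finset.subset_insert _ _)
  · intro i
    dsimp only
    split_ifs
    · exact Finset.union_subset_union_left (hD i)
    · exact (hD i).trans Finset.subset_union_left
  · intro f
    simp only [Finset.mem_union, Finset.mem_erase]
    constructor
    · rintro (⟨hne, hfF⟩ | hfN)
      · obtain ⟨i, hi⟩ := (hF f).1 hfF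
        refine ⟨i, ?_⟩
        split_ifs <;> simp [hne, hi]
      · exact ⟨j, by simp [hfN]⟩
    · rintro ⟨i, hi⟩
      split_ifs at hi with hij
      · simp only [Finset.mem_union, Finset.mem_erase] at hi
        exact hi.imp_left fun h => ⟨h.1, (hF f).2 ⟨i, h.2⟩⟩
      · refine Or.inl ⟨?_, (hF f).2 ⟨i, hi⟩⟩
        rintro rfl
        exact hij (hdisj _ _ _ hi hj)
  · have key : ∀ i f, f ∈ (if i = j then (H i).erase {x, y, z} ∪ N else H i) →
        f ∈ H i ∨ (i = j ∧ f ∈ N) := by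
      intro i f h
      split_ifs at h with hij
      · simp only [Finset.mem_union, Finset.mem_erase] at h
        exact h.imp And.right fun h => ⟨hij, h⟩
      · exact Or.inl h
    intro i k f hi hk
    rcases key i f hi with hiH | ⟨hij, hiN⟩ <;> rcases key k f hk with hkH | ⟨hkj, hkN⟩
    · exact hdisj _ _ _ hiH hkH
    · exact absurd ((hF f).2 ⟨_, hiH⟩) (hnew f hkN)
    · exact absurd ((hF f).2 ⟨_, hkH⟩) (hnew f hiN)
    · exact hij.trans hkj.symm
  · have hcard : ∀ i, (if i = j then insert v (W i) else W i).card
        = (W i).card + if i = j then 1 else 0 := by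
      intro i
      split_ifs
      · exact Finset.card_insert_of_notMem (hvW i)
      · rfl
    simp only [hcard, Finset.sum_add_distrib, Finset.card_insert_of_notMem hv, ← hsum]
    simp only [Finset.sum_ite_eq', Finset.mem_univ, if_true]

theorem eq_triangle_or_splits (h : IsStacked V E out F) :
    (V.card = 3 ∧ F = {V} ∧ ∀ u ∈ V, ∀ w ∈ V, u ≠ w → s(u, w) ∈ E) ∨ Splits V E F := by
  induction h with
  | base x y z hxy hyz hxz =>
    refine Or.inl ⟨Finset.card_eq_three.2 ⟨x, y, z, hxy, hxz, hyz, rfl⟩, rfl, ?_⟩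
    intro u hu w hw huw
    simp only [Finset.mem_insert, Finset.mem_singleton] at hu hw
    rcases hu with rfl | rfl | rfl <;> rcases hw with rfl | rfl | rfl <;>
      simp_all [Sym2.eq_swap]
  | stack x y z v hG hf hv ih =>
    right
    rcases ih with ⟨hcard, rfl, hE⟩ | ih
    · obtain rfl := Finset.mem_singleton.1 hf
      have hxy : x ≠ y := by
        rintro rfl
        have := Finset.card_le_two (a := x) (b := z)
        simp at hcard
        omega
      have hyz : y ≠ z := by
        rintro rfl
        have := Finset.card_le_two (a := x) (b := y)
        simp at hcard
        omega
      have hxz : x ≠ z := by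
        rintro rfl
        have := Finset.card_le_two (a := y) (b := x)
        simp at hcard
        omega
      exact splits_of_stack_triangle hxy hyz hxz hv hE
    · exact Splits.stack hG ih hf hv

end IsStacked

/-- Let `G` be a stacked triangulation with at least `7` vertices. If, among all
triangles occurring as a face at some stage of the construction of `G` and having at
least `4` interior vertices, `t` (with sub-triangulation vertex set `W`) has a minimal
number of interior vertices, then `t` has at most `10` interior vertices. -/
theorem minimal_triangle_small (V : Finset ℕ) (E : Finset (Sym2 ℕ)) (out : Finset ℕ)
    (F : Finset (Finset ℕ)) (hG : IsStacked V E out F) (hn : 7 ≤ V.card)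
    (t W : Finset ℕ) (ht : HasSubTri E F t W) (hW : 4 ≤ W.card - 3)
    (hmin : ∀ t' W' : Finset ℕ, HasSubTri E F t' W' → 4 ≤ W'.card - 3 → W.card ≤ W'.card) :
    W.card - 3 ≤ 10 := by
  obtain ⟨Et, Ft, hS, hE, hF⟩ := ht
  rcases hS.eq_triangle_or_splits with ⟨hcard, -⟩ | ⟨U, D, s, H, hU, -, hD, hH, -, hsum⟩
  · omega
  have hle : ∀ i, 4 ≤ (U i).card - 3 → W.card ≤ (U i).card := fun i =>
    hmin (s i) (U i) ⟨D i, H i, hU i, (hD i).trans hE,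
      fun f hf => hF ((hH f).2 ⟨i, hf⟩)⟩
  rw [Fin.sum_univ_three] at hsum
  have h0 := (hU 0).three_le_card
  have h1 := (hU 1).three_le_card
  have h2 := (hU 2).three_le_card
  have := hle 0
  have := hle 1
  have := hle 2
  omega

end Guarding
end

section
/- Every stacked triangulation with at most 6 vertices has an edge guard set of size 1, i.e., there is a single edge e such that every face contains an endpoint of e. -/
namespace Guarding

theorem IsStacked.face_subset_and_card {V : Finset ℕ} {E : Finset (Sym2 ℕ)} {out : Finset ℕ}
    {F : Finset (Finset ℕ)} (hG : IsStacked V E out F) :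
    ∀ f ∈ faces out F, f ⊆ V ∧ f.card = 3 := by
  induction hG with
  | base x y z hxy hyz hxz =>
    intro f hf
    obtain rfl : f = {x, y, z} := by simpa [faces] using hf
    exact ⟨subset_rfl, Finset.card_eq_three.2 ⟨x, y, z, hxy, hxz, hyz, rfl⟩⟩
  | @stack V E out F x y z v hG hT hv ih =>
    obtain ⟨hsub, hcard⟩ := ih {x, y, z} (Finset.mem_insert_of_mem hT)
    have hne : x ≠ y ∧ y ≠ z ∧ x ≠ z := by
      refine ⟨?_, ?_, ?_⟩ <;> rintro rfl <;> grind
    intro f hf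
    by_cases hold : f ∈ faces out F
    · exact ⟨(ih f hold).1.trans (Finset.subset_insert _ _), (ih f hold).2⟩
    · simp only [faces, Finset.mem_insert, Finset.mem_union, Finset.mem_erase,
        Finset.mem_singleton] at hf hold
      grind

/-- After stacking into the face `{x, y, z}`, every new face shares two vertices with it. -/
theorem mem_faces_stack {out : Finset ℕ} {F : Finset (Finset ℕ)} {x y z v : ℕ}
    (hT : ({x, y, z} : Finset ℕ).card = 3) {f : Finset ℕ}
    (hf : f ∈ faces out ((F.erase {x, y, z}) ∪ {{v, x, y}, {v, y, z}, {v, z, x}})) :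
    f ∈ faces out F ∨ 2 ≤ (f ∩ {x, y, z}).card := by
  have hne : x ≠ y ∧ y ≠ z ∧ x ≠ z := by
    refine ⟨?_, ?_, ?_⟩ <;> rintro rfl <;> grind
  obtain ⟨hxy, hyz, hxz⟩ := hne
  have key : ∀ a b : ℕ, a ≠ b → a ∈ ({x, y, z} : Finset ℕ) → b ∈ ({x, y, z} : Finset ℕ) →
      2 ≤ (({v, a, b} : Finset ℕ) ∩ {x, y, z}).card := fun a b hab ha hb ↦
    Finset.one_lt_card.2 ⟨a, by simp_all, b, by simp_all, hab⟩
  simp only [faces, Finset.mem_insert, Finset.mem_union, Finset.mem_erase,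
    Finset.mem_singleton] at hf ⊢
  rcases hf with h | ⟨-, h⟩ | rfl | rfl | rfl
  · exact Or.inl (Or.inl h)
  · exact Or.inl (Or.inr h)
  · exact Or.inr (key x y hxy (by simp) (by simp))
  · exact Or.inr (key y z hyz (by simp) (by simp))
  · exact Or.inr (key z x hxz.symm (by simp) (by simp))

/-- A stacked triangulation with at most four vertices is a complete graph. -/
theorem IsStacked.mem_edges_of_card_le_four {V : Finset ℕ} {E : Finset (Sym2 ℕ)}
    {out : Finset ℕ} {F : Finset (Finset ℕ)} (hG : IsStacked V E out F) (hn : V.card ≤ 4) :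
    ∀ u ∈ V, ∀ w ∈ V, u ≠ w → s(u, w) ∈ E := by
  induction hG with
  | base x y z hxy hyz hxz =>
    simp only [Finset.mem_insert, Finset.mem_singleton, Sym2.eq_iff]
    grind
  | @stack V E out F x y z v hG hT hv ih =>
    obtain ⟨hsub, hcard⟩ := hG.face_subset_and_card {x, y, z} (Finset.mem_insert_of_mem hT)
    rw [Finset.card_insert_of_notMem hv] at hn
    obtain rfl : {x, y, z} = V := Finset.eq_of_subset_of_card_le hsub (by omega)
    intro u hu w hw huw
    have ih' := ih (by omega) u
    simp only [Finset.mem_insert, Finset.mem_union, Finset.mem_singleton, Sym2.eq_iff]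
      at hu hw ih' ⊢
    grind

/-- With at most five vertices, some triangle shares two vertices with every face. -/
theorem IsStacked.exists_triangle_of_card_le_five {V : Finset ℕ} {E : Finset (Sym2 ℕ)}
    {out : Finset ℕ} {F : Finset (Finset ℕ)} (hG : IsStacked V E out F) (hn : V.card ≤ 5) :
    ∃ T : Finset ℕ, T.card = 3 ∧ (∀ u ∈ T, ∀ w ∈ T, u ≠ w → s(u, w) ∈ E) ∧
      ∀ f ∈ faces out F, 2 ≤ (f ∩ T).card := by
  cases hG with
  | base x y z hxy hyz hxz =>
    have hcard : ({x, y, z} : Finset ℕ).card = 3 :=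
      Finset.card_eq_three.2 ⟨x, y, z, hxy, hxz, hyz, rfl⟩
    refine ⟨{x, y, z}, hcard,
      (IsStacked.base x y z hxy hyz hxz).mem_edges_of_card_le_four (by omega), ?_⟩
    intro f hf
    obtain rfl : f = {x, y, z} := by simpa [faces] using hf
    rw [Finset.inter_self]
    omega
  | @stack V E _ F x y z v hG hT hv =>
    obtain ⟨hsub, hcard⟩ := hG.face_subset_and_card {x, y, z} (Finset.mem_insert_of_mem hT)
    rw [Finset.card_insert_of_notMem hv] at hn
    refine ⟨{x, y, z}, hcard, fun u hu w hw huw ↦ Finset.mem_union_left _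
      (hG.mem_edges_of_card_le_four (by omega) u (hsub hu) w (hsub hw) huw), fun f hf ↦ ?_⟩
    rcases mem_faces_stack hcard hf with h | h
    · obtain ⟨hfsub, hfcard⟩ := hG.face_subset_and_card f h
      have := Finset.card_union_add_card_inter f {x, y, z}
      have := Finset.card_le_card (Finset.union_subset hfsub hsub)
      omega
    · exact h

/-- An edge of a triangle `T` guards every set that contains at least two vertices of `T`. -/
theorem exists_mem_edge_of_two_le_card_inter {T f : Finset ℕ} {p q : ℕ} (hT : T.card = 3)
    (hp : p ∈ T) (hq : q ∈ T) (hpq : p ≠ q) (hf : 2 ≤ (f ∩ T).card) :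
    ∃ u ∈ s(p, q), u ∈ f := by
  have hsub : ({p, q} : Finset ℕ) ⊆ T := by simp [Finset.insert_subset_iff, hp, hq]
  obtain ⟨u, hu⟩ := Finset.inter_nonempty_of_card_lt_card_add_card hsub
    (Finset.inter_subset_right (s₁ := f)) (by rw [Finset.card_pair hpq]; omega)
  exact ⟨u, by simp_all, by simp_all⟩

/-- Every stacked triangulation with at most `6` vertices has an edge guard set of size
one: a single edge `e` such that every face contains an endpoint of `e`. -/
theorem small_stacked_one_guard (V : Finset ℕ) (E : Finset (Sym2 ℕ)) (out : Finset ℕ)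
    (F : Finset (Finset ℕ)) (hG : IsStacked V E out F) (hn : V.card ≤ 6) :
    ∃ e ∈ E, ∀ f ∈ faces out F, ∃ u ∈ (e : Sym2 ℕ), u ∈ f := by
  cases hG with
  | base x y z hxy hyz hxz =>
    refine ⟨s(x, y), by simp, fun f hf ↦ ⟨x, by simp, ?_⟩⟩
    obtain rfl : f = {x, y, z} := by simpa [faces] using hf
    simp
  | @stack V E _ F x y z v hG hT hv =>
    have hface : {x, y, z} ∈ faces out F := Finset.mem_insert_of_mem hT
    have hcard := (hG.face_subset_and_card _ hface).2
    rw [Finset.card_insert_of_notMem hv] at hn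
    obtain ⟨T, hTcard, hTE, hTF⟩ := hG.exists_triangle_of_card_le_five (by omega)
    obtain ⟨p, hp, q, hq, hpq⟩ := Finset.one_lt_card.1 (hTF _ hface)
    rw [Finset.mem_inter] at hp hq
    refine ⟨s(p, q), Finset.mem_union_left _ (hTE p hp.2 q hq.2 hpq), fun f hf ↦ ?_⟩
    rcases mem_faces_stack hcard hf with h | h
    · exact exists_mem_edge_of_two_le_card_inter hTcard hp.2 hq.2 hpq (hTF f h)
    · exact exists_mem_edge_of_two_le_card_inter hcard hp.1 hq.1 hpq h

end Guarding
end

section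
/- Let G be a stacked triangulation with at least 4 vertices and outer face {x,y,z}, and let v be the unique vertex of G adjacent to all of x, y, z. If height(G) ≤ 3, then every face of G contains at least one vertex from {v,x,y,z}. -/
namespace Guarding

/-- `HeightLe V E out F n` means that the stacked triangulation with data `(V, E, out, F)`
has height at most `n`: a triangle has height `0`, and otherwise the height is `1` plus
the maximum height of the three sub-triangulations inside `{v,x,y}`, `{v,y,z}`, `{v,z,x}`,
where `v` is the unique vertex adjacent to all three outer vertices `x, y, z`. -/
inductive HeightLe : Finset ℕ → Finset (Sym2 ℕ) → Finset ℕ → Finset (Finset ℕ) → ℕ → Prop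
  | tri (x y z : ℕ) (hxy : x ≠ y) (hyz : y ≠ z) (hxz : x ≠ z) (n : ℕ) :
      HeightLe {x, y, z} {s(x, y), s(y, z), s(x, z)} {x, y, z} {{x, y, z}} n
  | node (x y z v : ℕ) (V1 V2 V3 : Finset ℕ) (E1 E2 E3 : Finset (Sym2 ℕ))
      (F1 F2 F3 : Finset (Finset ℕ)) (n : ℕ)
      (h1 : IsStacked V1 E1 {v, x, y} F1) (h2 : IsStacked V2 E2 {v, y, z} F2)
      (h3 : IsStacked V3 E3 {v, z, x} F3)
      (hl1 : HeightLe V1 E1 {v, x, y} F1 n) (hl2 : HeightLe V2 E2 {v, y, z} F2 n)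
      (hl3 : HeightLe V3 E3 {v, z, x} F3 n) :
      HeightLe (V1 ∪ V2 ∪ V3) (E1 ∪ E2 ∪ E3) {x, y, z} (F1 ∪ F2 ∪ F3) (n + 1)

/-- The outer face of a stacked triangulation is a triangle of the graph. -/
theorem IsStacked.outer_triangle {V : Finset ℕ} {E : Finset (Sym2 ℕ)} {out : Finset ℕ}
    {F : Finset (Finset ℕ)} (h : IsStacked V E out F) :
    out.card = 3 ∧ out ⊆ V ∧ ∀ a ∈ out, ∀ b ∈ out, a ≠ b → s(a, b) ∈ E := by
  induction h with
  | base x y z hxy hyz hxz =>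
    refine ⟨Finset.card_eq_three.2 ⟨x, y, z, hxy, hxz, hyz, rfl⟩, subset_rfl, ?_⟩
    intro a ha b hb hab
    simp only [Finset.mem_insert, Finset.mem_singleton] at ha hb
    rcases ha with rfl | rfl | rfl <;> rcases hb with rfl | rfl | rfl <;> simp_all
  | stack x y z v _ _ _ ih =>
    exact ⟨ih.1, ih.2.1.trans (Finset.subset_insert _ _), fun a ha b hb hab =>
      Finset.mem_union_left _ (ih.2.2 a ha b hb hab)⟩

theorem ne_of_card_triple {a b c : ℕ} (h : ({a, b, c} : Finset ℕ).card = 3) :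
    a ≠ b ∧ a ≠ c ∧ b ≠ c := by
  refine ⟨?_, ?_, ?_⟩ <;> rintro rfl
  · have := Finset.card_le_two (a := a) (b := c)
    simp_all
  · have := Finset.card_le_two (a := b) (b := a)
    rw [Finset.insert_comm] at h
    simp_all
  · have := Finset.card_le_two (a := a) (b := b)
    simp_all

theorem HeightLe.faces_eq_of_zero {V : Finset ℕ} {E : Finset (Sym2 ℕ)} {out : Finset ℕ}
    {F : Finset (Finset ℕ)} (h : HeightLe V E out F 0) : F = {out} := by
  cases h
  rfl

/-- At height at most one, every inner face has two outer vertices; equivalently, it has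
an outer vertex different from any prescribed vertex. -/
theorem HeightLe.exists_outer_ne_of_one {V : Finset ℕ} {E : Finset (Sym2 ℕ)} {out : Finset ℕ}
    {F : Finset (Finset ℕ)} (h : HeightLe V E out F 1) (c : ℕ) :
    ∀ f ∈ F, ∃ u ∈ out, u ∈ f ∧ u ≠ c := by
  have pair {a b : ℕ} {f : Finset ℕ} (hab : a ≠ b) (ha : a ∈ out) (hb : b ∈ out)
      (haf : a ∈ f) (hbf : b ∈ f) : ∃ u ∈ out, u ∈ f ∧ u ≠ c := by
    by_cases hac : a = c
    · exact ⟨b, hb, hbf, fun hbc => hab (hac.trans hbc.symm)⟩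
    · exact ⟨a, ha, haf, hac⟩
  intro f hf
  cases h with
  | tri x y z hxy =>
    rw [Finset.mem_singleton] at hf
    subst hf
    exact pair hxy (by simp) (by simp) (by simp) (by simp)
  | node x y z v V1 V2 V3 E1 E2 E3 F1 F2 F3 n h1 h2 h3 hl1 hl2 hl3 =>
    rw [hl1.faces_eq_of_zero, hl2.faces_eq_of_zero, hl3.faces_eq_of_zero] at hf
    simp only [Finset.mem_union, Finset.mem_singleton] at hf
    rcases hf with (rfl | rfl) | rfl
    · exact pair (ne_of_card_triple h1.outer_triangle.1).2.2
        (by simp) (by simp) (by simp) (by simp)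
    · exact pair (ne_of_card_triple h2.outer_triangle.1).2.2
        (by simp) (by simp) (by simp) (by simp)
    · exact pair (ne_of_card_triple h3.outer_triangle.1).2.2
        (by simp) (by simp) (by simp) (by simp)

/-- At height at most two, every inner face has an outer vertex. -/
theorem HeightLe.exists_outer_of_two {V : Finset ℕ} {E : Finset (Sym2 ℕ)} {out : Finset ℕ}
    {F : Finset (Finset ℕ)} (h : HeightLe V E out F 2) :
    ∀ f ∈ F, ∃ u ∈ out, u ∈ f := by
  intro f hf
  cases h with
  | tri x y z =>
    rw [Finset.mem_singleton] at hf
    exact ⟨x, by simp, by simp [hf]⟩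
  | node x y z v V1 V2 V3 E1 E2 E3 F1 F2 F3 n h1 h2 h3 hl1 hl2 hl3 =>
    simp only [Finset.mem_union] at hf
    rcases hf with (hf | hf) | hf
    · obtain ⟨u, hu, huf, huv⟩ := hl1.exists_outer_ne_of_one v f hf
      exact ⟨u, by simp at hu ⊢; tauto, huf⟩
    · obtain ⟨u, hu, huf, huv⟩ := hl2.exists_outer_ne_of_one v f hf
      exact ⟨u, by simp at hu ⊢; tauto, huf⟩
    · obtain ⟨u, hu, huf, huv⟩ := hl3.exists_outer_ne_of_one v f hf
      exact ⟨u, by simp at hu ⊢; tauto, huf⟩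

/-- At height at most three, a triangulation that is not a triangle has a vertex adjacent to
all outer vertices which together with them meets every inner face. -/
theorem HeightLe.exists_center_of_three {V : Finset ℕ} {E : Finset (Sym2 ℕ)} {out : Finset ℕ}
    {F : Finset (Finset ℕ)} (h : HeightLe V E out F 3) (hV : 4 ≤ V.card) :
    ∃ w ∈ V, (∀ a ∈ out, s(w, a) ∈ E) ∧ ∀ f ∈ F, ∃ u ∈ insert w out, u ∈ f := by
  cases h with
  | tri x y z =>
    have := Finset.card_le_three (a := x) (b := y) (c := z)
    omega
  | node x y z v V1 V2 V3 E1 E2 E3 F1 F2 F3 n h1 h2 h3 hl1 hl2 hl3 =>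
    obtain ⟨c1, s1, e1⟩ := h1.outer_triangle
    obtain ⟨c2, -, e2⟩ := h2.outer_triangle
    obtain ⟨hvx, hvy, -⟩ := ne_of_card_triple c1
    obtain ⟨-, hvz, -⟩ := ne_of_card_triple c2
    refine ⟨v, ?_, ?_, ?_⟩
    · exact Finset.mem_union_left _ (Finset.mem_union_left _ (s1 (by simp)))
    · intro a ha
      simp only [Finset.mem_insert, Finset.mem_singleton] at ha
      simp only [Finset.mem_union]
      rcases ha with rfl | rfl | rfl
      · exact Or.inl (Or.inl (e1 _ (by simp) _ (by simp) hvx))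
      · exact Or.inl (Or.inl (e1 _ (by simp) _ (by simp) hvy))
      · exact Or.inl (Or.inr (e2 _ (by simp) _ (by simp) hvz))
    · intro f hf
      simp only [Finset.mem_union] at hf
      rcases hf with (hf | hf) | hf
      · obtain ⟨u, hu, huf⟩ := hl1.exists_outer_of_two f hf
        exact ⟨u, by simp at hu ⊢; tauto, huf⟩
      · obtain ⟨u, hu, huf⟩ := hl2.exists_outer_of_two f hf
        exact ⟨u, by simp at hu ⊢; tauto, huf⟩
      · obtain ⟨u, hu, huf⟩ := hl3.exists_outer_of_two f hf
        exact ⟨u, by simp at hu ⊢; tauto, huf⟩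

/-- Let `G` be a stacked triangulation with at least `4` vertices, outer face `{x,y,z}`
and `v` the unique vertex adjacent to all of `x, y, z`. If `height(G) ≤ 3`, then every
face of `G` contains at least one vertex from `{v,x,y,z}`. -/
theorem height_le_three_faces (V : Finset ℕ) (E : Finset (Sym2 ℕ))
    (F : Finset (Finset ℕ)) (x y z v : ℕ)
    (hG : IsStacked V E {x, y, z} F) (hn : 4 ≤ V.card)
    (hvV : v ∈ V) (hvx : s(v, x) ∈ E) (hvy : s(v, y) ∈ E) (hvz : s(v, z) ∈ E)
    (hvu : ∀ u ∈ V, s(u, x) ∈ E → s(u, y) ∈ E → s(u, z) ∈ E → u = v)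
    (hh : HeightLe V E {x, y, z} F 3) :
    ∀ f ∈ faces {x, y, z} F, ∃ u ∈ ({v, x, y, z} : Finset ℕ), u ∈ f := by
  obtain ⟨w, hw, hadj, hfaces⟩ := hh.exists_center_of_three hn
  obtain rfl : w = v :=
    hvu w hw (hadj x (by simp)) (hadj y (by simp)) (hadj z (by simp))
  intro f hf
  rcases Finset.mem_insert.1 hf with rfl | hf
  · exact ⟨x, by simp, by simp⟩
  · exact hfaces f hf

end Guarding
end

section
/- Let G be a stacked triangulation on exactly 5 vertices with outer face {x,y,z}. Then at least one of the three outer edges xy, yz, zx, taken as a singleton set, is an edge guard set of G. -/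
namespace Guarding

theorem IsStacked.card_outer {V : Finset ℕ} {E : Finset (Sym2 ℕ)} {out : Finset ℕ}
    {F : Finset (Finset ℕ)} (h : IsStacked V E out F) : out.card = 3 := by
  induction h with
  | base x y z hxy hyz hxz => exact Finset.card_eq_three.2 ⟨x, y, z, hxy, hxz, hyz, rfl⟩
  | stack _ _ _ _ _ _ _ ih => exact ih

theorem IsStacked.three_le_card_s15 {V : Finset ℕ} {E : Finset (Sym2 ℕ)} {out : Finset ℕ}
    {F : Finset (Finset ℕ)} (h : IsStacked V E out F) : 3 ≤ V.card := by
  induction h with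
  | base x y z hxy hyz hxz =>
    exact (Finset.card_eq_three.2 ⟨x, y, z, hxy, hxz, hyz, rfl⟩).ge
  | stack _ _ _ _ _ _ hv ih => rw [Finset.card_insert_of_notMem hv]; omega

theorem IsStacked.outer_edge_mem {V : Finset ℕ} {E : Finset (Sym2 ℕ)} {out : Finset ℕ}
    {F : Finset (Finset ℕ)} (h : IsStacked V E out F) {a b : ℕ} (ha : a ∈ out)
    (hb : b ∈ out) (hab : a ≠ b) : s(a, b) ∈ E := by
  induction h with
  | base x y z hxy hyz hxz =>
    simp only [Finset.mem_insert, Finset.mem_singleton, Sym2.eq_iff] at *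
    grind
  | stack _ _ _ _ _ _ _ ih => exact Finset.mem_union_left _ (ih ha hb)

/-- With three vertices, the only inner face has the same boundary as the outer face. -/
theorem IsStacked.inner_face_eq_outer {V : Finset ℕ} {E : Finset (Sym2 ℕ)} {out : Finset ℕ}
    {F : Finset (Finset ℕ)} (h : IsStacked V E out F) (hn : V.card = 3)
    {f : Finset ℕ} (hf : f ∈ F) : f = out := by
  cases h with
  | base => exact Finset.mem_singleton.1 hf
  | stack _ _ _ _ hG _ hv =>
    rw [Finset.card_insert_of_notMem hv] at hn
    have := hG.three_le_card_s15
    omega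

/-- With four vertices, every inner face contains two outer vertices. -/
theorem IsStacked.exists_outer_pair_mem {V : Finset ℕ} {E : Finset (Sym2 ℕ)}
    {out : Finset ℕ} {F : Finset (Finset ℕ)} (h : IsStacked V E out F) (hn : V.card = 4)
    {f : Finset ℕ} (hf : f ∈ F) :
    ∃ a ∈ out, ∃ b ∈ out, a ≠ b ∧ a ∈ f ∧ b ∈ f := by
  cases h with
  | base x y z hxy hyz hxz =>
    rw [Finset.card_eq_three.2 ⟨x, y, z, hxy, hxz, hyz, rfl⟩] at hn
    omega
  | stack p q r v hG hf' hv =>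
    rw [Finset.card_insert_of_notMem hv] at hn
    have hout := hG.inner_face_eq_outer (by omega) hf'
    have hcard := hG.card_outer
    subst hout
    have hne : p ≠ q ∧ q ≠ r ∧ r ≠ p := by
      refine ⟨?_, ?_, ?_⟩ <;> rintro rfl
      · rw [Finset.insert_eq_of_mem (by simp)] at hcard
        have := Finset.card_le_two (a := p) (b := r)
        omega
      · simp only [Finset.pair_eq_singleton] at hcard
        have := Finset.card_le_two (a := p) (b := q)
        omega
      · rw [Finset.insert_eq_of_mem (by simp)] at hcard
        have := Finset.card_le_two (a := q) (b := r)
        omega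
    obtain ⟨hpq, hqr, hrp⟩ := hne
    simp only [Finset.mem_union, Finset.mem_erase, Finset.mem_insert,
      Finset.mem_singleton] at hf
    rcases hf with ⟨hne, hfF⟩ | rfl | rfl | rfl
    · exact absurd (hG.inner_face_eq_outer (by omega) hfF) hne
    · exact ⟨p, by simp, q, by simp, hpq, by simp, by simp⟩
    · exact ⟨q, by simp, r, by simp, hqr, by simp, by simp⟩
    · exact ⟨r, by simp, p, by simp, hrp, by simp, by simp⟩

/-- With five vertices, some two outer vertices together meet every inner face. -/
theorem IsStacked.exists_outer_pair_guarding {V : Finset ℕ} {E : Finset (Sym2 ℕ)}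
    {out : Finset ℕ} {F : Finset (Finset ℕ)} (h : IsStacked V E out F) (hn : V.card = 5) :
    ∃ a ∈ out, ∃ b ∈ out, a ≠ b ∧ ∀ f ∈ F, a ∈ f ∨ b ∈ f := by
  cases h with
  | base x y z hxy hyz hxz =>
    rw [Finset.card_eq_three.2 ⟨x, y, z, hxy, hxz, hyz, rfl⟩] at hn
    omega
  | stack p q r v hG hf' hv =>
    rw [Finset.card_insert_of_notMem hv] at hn
    obtain ⟨a, ha, b, hb, hab, haf, hbf⟩ := hG.exists_outer_pair_mem (by omega) hf'
    refine ⟨a, ha, b, hb, hab, fun f hf => ?_⟩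
    simp only [Finset.mem_union, Finset.mem_erase, Finset.mem_insert,
      Finset.mem_singleton] at hf haf hbf
    rcases hf with ⟨-, hfF⟩ | rfl | rfl | rfl
    · obtain ⟨c, hc, d, hd, hcd, hcf, hdf⟩ := hG.exists_outer_pair_mem (by omega) hfF
      obtain ⟨x, y, z, -, -, -, rfl⟩ := Finset.card_eq_three.1 hG.card_outer
      simp only [Finset.mem_insert, Finset.mem_singleton] at ha hb hc hd
      grind
    all_goals
      simp only [Finset.mem_insert, Finset.mem_singleton]
      grind

theorem IsStacked.isGuardSet_singleton {V : Finset ℕ} {E : Finset (Sym2 ℕ)}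
    {out : Finset ℕ} {F : Finset (Finset ℕ)} (h : IsStacked V E out F) {a b : ℕ}
    (ha : a ∈ out) (hb : b ∈ out) (hab : a ≠ b) (hF : ∀ f ∈ F, a ∈ f ∨ b ∈ f) :
    IsGuardSet E out F {s(a, b)} := by
  refine ⟨Finset.singleton_subset_iff.2 (h.outer_edge_mem ha hb hab), fun f hf => ?_⟩
  have hf' : a ∈ f ∨ b ∈ f := by
    rcases Finset.mem_insert.1 hf with rfl | hf
    · exact Or.inl ha
    · exact hF f hf
  rcases hf' with haf | hbf
  · exact ⟨a, ⟨s(a, b), by simp, by simp⟩, haf⟩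
  · exact ⟨b, ⟨s(a, b), by simp, by simp⟩, hbf⟩

/-- Every stacked triangulation on exactly `5` vertices with outer face `{x,y,z}` is
guarded by one of its three outer edges `xy`, `yz`, `zx` (as a singleton guard set). -/
theorem five_vertex_outer_edge_guard (V : Finset ℕ) (E : Finset (Sym2 ℕ))
    (F : Finset (Finset ℕ)) (x y z : ℕ)
    (hxy : x ≠ y) (hyz : y ≠ z) (hxz : x ≠ z)
    (hG : IsStacked V E {x, y, z} F) (hn : V.card = 5) :
    IsGuardSet E {x, y, z} F {s(x, y)} ∨ IsGuardSet E {x, y, z} F {s(y, z)} ∨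
      IsGuardSet E {x, y, z} F {s(z, x)} := by
  obtain ⟨a, ha, b, hb, hab, hF⟩ := hG.exists_outer_pair_guarding hn
  have hg := hG.isGuardSet_singleton ha hb hab hF
  simp only [Finset.mem_insert, Finset.mem_singleton] at ha hb
  rcases ha with rfl | rfl | rfl <;> rcases hb with rfl | rfl | rfl <;>
    first
    | exact absurd rfl hab
    | exact Or.inl hg
    | exact Or.inr (Or.inl hg)
    | exact Or.inr (Or.inr hg)
    | (rw [Sym2.eq_swap] at hg
       first
       | exact Or.inl hg
       | exact Or.inr (Or.inl hg)
       | exact Or.inr (Or.inr hg))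

end Guarding
end
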